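/- There exists P such that for every prime p ≥ P the following holds. Let T = φ(p-1) - 1 and let q be the smallest prime divisor of 2^T - 1. Then the 2-adic complexity of the sequence (s_n) satisfies C(s_n) ≥ ⌊log_2(q)⌋. -/

import Mathlib

/-- The primitive roots modulo `p` in increasing order: `g_1 < g_2 < … < g_{φ(p-1)}`
(0-indexed as a sorted list). -/
noncomputable def primRootsList (p : ℕ) : List ℕ :=
  ((Finset.Ico 1 p).filter fun g : ℕ => orderOf ((g : ZMod p)) = p - 1).sort (· ≤ ·)

/-- The binary sequence `s_n ≡ g_{n+1} + g_{n+2} (mod 2)` of period `T = φ(p-1) - 1`,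
extended `T`-periodically. -/
noncomputable def seqS (p n : ℕ) : ℕ :=
  ((primRootsList p).getD (n % (Nat.totient (p - 1) - 1)) 0 +
    (primRootsList p).getD (n % (Nat.totient (p - 1) - 1) + 1) 0) % 2

/-- `S(2) = Σ_{n=0}^{T-1} s_n 2^n ∈ ℤ≥0`, `T = φ(p-1) - 1`. -/
noncomputable def Stwo (p : ℕ) : ℕ :=
  ∑ n ∈ Finset.range (Nat.totient (p - 1) - 1), seqS p n * 2 ^ n

/-- The `2`-adic complexity `C(s_n) = ⌊log₂((2^T - 1)/gcd(2^T - 1, S(2)))⌋`. -/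
noncomputable def twoAdicComp (p : ℕ) : ℕ :=
  Nat.log 2 ((2 ^ (Nat.totient (p - 1) - 1) - 1) /
    Nat.gcd (2 ^ (Nat.totient (p - 1) - 1) - 1) (Stwo p))

/-- `f` is a linear combination of multiplicative characters of `F` whose coefficients have
absolute values summing to at most `M`. -/
def HasCharExpansion {F : Type*} [Field F] (f : F → ℂ) (M : ℝ) : Prop :=
  ∃ (ι : Type) (_ : Fintype ι) (a : ι → ℂ) (χ : ι → MulChar F ℂ),
    (∀ x, f x = ∑ i, a i * χ i x) ∧ ∑ i, ‖a i‖ ≤ M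

section CharExpansion

variable {F : Type*} [Field F]

lemma hasCharExpansion_mulChar (χ : MulChar F ℂ) : HasCharExpansion (fun x => χ x) 1 :=
  ⟨Unit, inferInstance, fun _ => 1, fun _ => χ, by simp, by simp⟩

lemma HasCharExpansion.mul {f g : F → ℂ} {M N : ℝ} (hM : 0 ≤ M)
    (hf : HasCharExpansion f M) (hg : HasCharExpansion g N) :
    HasCharExpansion (fun x => f x * g x) (M * N) := by
  obtain ⟨ι, _, a, χ, hf, ha⟩ := hf
  obtain ⟨κ, _, b, ψ, hg, hb⟩ := hg
  refine ⟨ι × κ, inferInstance, fun i => a i.1 * b i.2, fun i => χ i.1 * ψ i.2, fun x => ?_, ?_⟩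
  · beta_reduce
    rw [hf, hg, Finset.sum_mul_sum, Fintype.sum_prod_type]
    simp only [MulChar.mul_apply]
    exact Finset.sum_congr rfl fun i _ => Finset.sum_congr rfl fun j _ => by ring
  · simp only [norm_mul]
    rw [Fintype.sum_prod_type]
    dsimp only
    rw [← Finset.sum_mul_sum]
    exact mul_le_mul ha hb (Finset.sum_nonneg fun _ _ => norm_nonneg _) hM

open scoped Classical in
/-- The indicator function of the nonzero `x` with `χ x ≠ 1`, for a character `χ` of
exponent `m`. -/
lemma hasCharExpansion_apply_ne_one {χ : MulChar F ℂ} {m : ℕ} (hm : 0 < m) (hχ : χ ^ m = 1) :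
    HasCharExpansion (fun x => if x ≠ 0 ∧ χ x ≠ 1 then 1 else 0) 2 := by
  refine ⟨Option (Fin m), inferInstance, fun i => i.elim 1 fun _ => -(1 / m : ℂ),
    fun i => i.elim 1 fun j => χ ^ (j : ℕ), fun x => ?_, ?_⟩
  · rw [Fintype.sum_option]
    rcases eq_or_ne x 0 with rfl | hx
    · simp [MulChar.map_zero]
    have hm' : (m : ℂ) ≠ 0 := by exact_mod_cast hm.ne'
    have h1 : (1 : MulChar F ℂ) x = 1 := MulChar.one_apply hx.isUnit
    have hpow : ∀ k : ℕ, (χ ^ k) x = χ x ^ k := fun k => by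
      induction k with
      | zero => simpa using h1
      | succ k ih => rw [pow_succ, MulChar.mul_apply, ih, pow_succ]
    simp only [Option.elim, hpow, h1, ← Finset.mul_sum]
    rw [Fin.sum_univ_eq_sum_range (fun k => χ x ^ k) m]
    by_cases h : χ x = 1
    · simp [h, hm']
    · rw [geom_sum_eq h, ← hpow, hχ, h1]
      simp [h, hx]
  · rw [Fintype.sum_option]
    have hm' : (m : ℝ) ≠ 0 := by exact_mod_cast hm.ne'
    simp [hm']
    norm_num

lemma HasCharExpansion.prod {α : Type*} {f : α → F → ℂ} {M : ℝ} (hM : 0 ≤ M) (s : Finset α)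
    (hf : ∀ i ∈ s, HasCharExpansion (f i) M) :
    HasCharExpansion (fun x => (1 : MulChar F ℂ) x * ∏ i ∈ s, f i x) (M ^ s.card) := by
  classical
  induction s using Finset.induction_on with
  | empty => simpa using hasCharExpansion_mulChar (1 : MulChar F ℂ)
  | insert i s hi ih =>
    rw [Finset.card_insert_of_notMem hi, pow_succ']
    have := (hf i (by simp)).mul hM (ih fun j hj => hf j (by simp [hj]))
    convert this using 2 with x
    rw [Finset.prod_insert hi]
    ring

variable [Fintype F]

lemma orderOf_eq_card_sub_one_iff (χ : ℕ → MulChar F ℂ)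
    (hχ : ∀ l ∈ (Fintype.card F - 1).primeFactors, orderOf (χ l) = l) {x : F} (hx : x ≠ 0) :
    orderOf x = Fintype.card F - 1 ↔ ∀ l ∈ (Fintype.card F - 1).primeFactors, χ l x ≠ 1 := by
  classical
  have hcard : Fintype.card Fˣ = Fintype.card F - 1 := Fintype.card_units F
  have hpos : 0 < Fintype.card F - 1 := hcard ▸ Fintype.card_pos
  constructor
  · intro hord l hl h1
    have hgen : ∀ y : Fˣ, y ∈ Subgroup.zpowers (Units.mk0 x hx) := by
      have : orderOf (Units.mk0 x hx) = Nat.card Fˣ := by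
        rw [← orderOf_units, Units.val_mk0, hord, Nat.card_eq_fintype_card, hcard]
      intro y
      rw [(Subgroup.card_eq_iff_eq_top _).1 ((Nat.card_zpowers _).trans this)]
      trivial
    have h : χ l = 1 := (MulChar.eq_iff hgen _ _).2 (by
      rw [Units.val_mk0, h1, MulChar.one_apply hx.isUnit])
    have := hχ l hl
    rw [h, orderOf_one] at this
    exact (Nat.prime_of_mem_primeFactors hl).one_lt.ne this
  · intro h
    obtain ⟨g, hg⟩ := IsCyclic.exists_generator (α := Fˣ)
    obtain ⟨k, hk⟩ := (Submonoid.mem_powers_iff _ _).1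
      ((mem_powers_iff_mem_zpowers).2 (hg (Units.mk0 x hx)))
    have hgord : orderOf g = Fintype.card F - 1 := by
      rw [orderOf_eq_card_of_forall_mem_zpowers hg, Nat.card_eq_fintype_card, hcard]
    have hxk : x = (g : F) ^ k := by
      rw [← Units.val_pow_eq_pow_val, hk, Units.val_mk0]
    refine orderOf_eq_of_pow_and_pow_div_prime hpos (FiniteField.pow_card_sub_one_eq_one x hx) ?_
    intro l hl hdvd h1
    refine h l (Nat.mem_primeFactors.2 ⟨hl, hdvd, hpos.ne'⟩) ?_
    obtain ⟨c, hc⟩ := hdvd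
    have hcpos : 0 < c := Nat.pos_of_ne_zero fun h0 => by simp [h0] at hc; omega
    rw [hc, Nat.mul_div_cancel_left _ hl.pos, hxk, ← pow_mul, ← Units.val_pow_eq_pow_val,
      Units.val_eq_one, ← orderOf_dvd_iff_pow_eq_one, hgord, hc] at h1
    obtain ⟨j, rfl⟩ := Nat.dvd_of_mul_dvd_mul_right hcpos h1
    have hl1 : χ l ^ l = 1 :=
      orderOf_dvd_iff_pow_eq_one.1 (hχ l (Nat.mem_primeFactors.2 ⟨hl, ⟨c, hc⟩, hpos.ne'⟩)).dvd
    have : χ l (g : F) ^ l = 1 := by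
      rw [← MulChar.pow_apply_coe, hl1, MulChar.one_apply_coe]
    rw [hxk, map_pow, pow_mul, this, one_pow]

/-- The indicator function of the generators of `Fˣ` expands into characters with
coefficients of total absolute value at most `2 ^ ω(#F - 1)`. -/
lemma hasCharExpansion_orderOf :
    HasCharExpansion (fun x : F => if orderOf x = Fintype.card F - 1 then 1 else 0)
      (2 ^ (Fintype.card F - 1).primeFactors.card) := by
  classical
  have hpos : 0 < Fintype.card F - 1 := by
    have := Fintype.one_lt_card (α := F); omega
  have hex : ∀ l : ℕ, ∃ χ : MulChar F ℂ,
      l ∈ (Fintype.card F - 1).primeFactors → orderOf χ = l := by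
    intro l
    by_cases hl : l ∈ (Fintype.card F - 1).primeFactors
    · obtain ⟨χ, h⟩ := MulChar.exists_mulChar_orderOf F (Nat.dvd_of_mem_primeFactors hl)
        (Complex.isPrimitiveRoot_exp l (Nat.prime_of_mem_primeFactors hl).ne_zero)
      exact ⟨χ, fun _ => h⟩
    · exact ⟨1, fun h => absurd h hl⟩
  choose χ hχ using hex
  have := HasCharExpansion.prod (F := F) (zero_le_two) (Fintype.card F - 1).primeFactors
    (f := fun l x => if x ≠ 0 ∧ χ l x ≠ 1 then 1 else 0) fun l hl =>
      hasCharExpansion_apply_ne_one (Nat.prime_of_mem_primeFactors hl).pos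
        (orderOf_dvd_iff_pow_eq_one.1 (hχ l hl).dvd)
  convert this using 2 with x
  rcases eq_or_ne x 0 with rfl | hx
  · simp [hpos.ne, MulChar.map_zero]
  · rw [MulChar.one_apply hx.isUnit, one_mul, Finset.prod_boole]
    simp only [orderOf_eq_card_sub_one_iff χ hχ hx, hx, ne_eq, not_false_eq_true, true_and]

end CharExpansion

section Correlation

variable {F : Type*} [Field F] [Fintype F]

lemma norm_jacobiSum_le {χ ψ : MulChar F ℂ} (h : ¬(χ = 1 ∧ ψ = 1)) :
    ‖jacobiSum χ ψ‖ ≤ √(Fintype.card F) := by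
  classical
  have hone : (1 : ℝ) ≤ √(Fintype.card F) :=
    Real.one_le_sqrt.2 (by exact_mod_cast Fintype.card_pos)
  by_cases hχ : χ = 1
  · rw [hχ, jacobiSum_one_nontrivial fun h' => h ⟨hχ, h'⟩]
    simpa using hone
  by_cases hψ : ψ = 1
  · rw [hψ, jacobiSum_comm, jacobiSum_one_nontrivial hχ]
    simpa using hone
  by_cases hχψ : χ * ψ = 1
  · rw [← inv_eq_iff_mul_eq_one] at hχψ
    rw [← hχψ, jacobiSum_nontrivial_inv hχ, norm_neg]
    have : ‖χ (-1)‖ = 1 := by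
      have h2 : χ (-1) ^ 2 = 1 := by rw [← map_pow]; simp
      exact Complex.norm_eq_one_of_pow_eq_one h2 two_ne_zero
    rw [this]
    exact hone
  · have hchar : ringChar ℂ ≠ ringChar F := by
      rw [ringChar.eq_zero]
      exact (CharP.ringChar_ne_zero_of_finite F).symm
    have hJ := jacobiSum_mul_jacobiSum_inv hchar hχ hψ hχψ
    have hstar : jacobiSum χ⁻¹ ψ⁻¹ = star (jacobiSum χ ψ) := by
      simp only [jacobiSum, star_sum, star_mul', MulChar.star_apply']
    rw [hstar] at hJ
    refine Real.le_sqrt_of_sq_le ?_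
    have := congrArg norm hJ
    rw [norm_mul, norm_star, Complex.norm_natCast] at this
    rw [sq, this]

lemma sum_mulChar_mul_shift (χ ψ : MulChar F ℂ) {h : F} (hh : h ≠ 0) :
    ∑ x, χ x * ψ (x + h) = χ (-h) * ψ h * jacobiSum χ ψ := by
  rw [jacobiSum, Finset.mul_sum, ← Equiv.sum_comp (Equiv.mulLeft₀ (-h) (neg_ne_zero.2 hh))]
  refine Finset.sum_congr rfl fun y _ => ?_
  have : -h * y + h = h * (1 - y) := by ring
  rw [Equiv.mulLeft₀_apply, this, map_mul, map_mul]
  ring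

lemma norm_mulChar_apply_of_ne_zero (χ : MulChar F ℂ) {x : F} (hx : x ≠ 0) : ‖χ x‖ = 1 := by
  have hpow : χ x ^ (Fintype.card F - 1) = 1 := by
    rw [← map_pow, FiniteField.pow_card_sub_one_eq_one x hx, map_one]
  have := Fintype.one_lt_card (α := F)
  exact Complex.norm_eq_one_of_pow_eq_one hpow (by omega)

open scoped Classical in
lemma norm_sum_mulChar_mul_shift_sub_le (χ ψ : MulChar F ℂ) {h : F} (hh : h ≠ 0) :
    ‖∑ x, χ x * ψ (x + h) - (if χ = 1 then 1 else 0) * (if ψ = 1 then 1 else 0) *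
      ((Fintype.card F : ℂ) - 2)‖ ≤ √(Fintype.card F) := by
  rw [sum_mulChar_mul_shift χ ψ hh]
  by_cases h1 : χ = 1 ∧ ψ = 1
  · rw [h1.1, h1.2, jacobiSum_one_one, MulChar.one_apply hh.isUnit,
      MulChar.one_apply (neg_ne_zero.2 hh).isUnit]
    simp
  · have : (if χ = 1 then 1 else 0) * (if ψ = 1 then 1 else 0) = (0 : ℂ) := by
      simpa using fun b a => h1 ⟨a, b⟩
    rw [this, zero_mul, sub_zero, norm_mul, norm_mul, norm_mulChar_apply_of_ne_zero χ
      (neg_ne_zero.2 hh), norm_mulChar_apply_of_ne_zero ψ hh, one_mul, one_mul]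
    exact norm_jacobiSum_le h1

open scoped Classical in
/-- The correlation of `f` with a nontrivial translate of itself is close to the value
predicted by the mean of `f` over `Fˣ`. -/
lemma HasCharExpansion.norm_correlation_sub_le {f : F → ℂ} {M : ℝ} (hf : HasCharExpansion f M)
    {h : F} (hh : h ≠ 0) :
    ‖∑ x, f x * f (x + h) - ((∑ x, f x) / ((Fintype.card F : ℂ) - 1)) ^ 2 *
      ((Fintype.card F : ℂ) - 2)‖ ≤ M ^ 2 * √(Fintype.card F) := by
  obtain ⟨ι, _, a, χ, hf, ha⟩ := hf
  have hq : (Fintype.card F : ℂ) - 1 ≠ 0 := by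
    rw [sub_ne_zero]
    exact_mod_cast (Fintype.one_lt_card (α := F)).ne'
  have hmean : (∑ x, f x) / ((Fintype.card F : ℂ) - 1) =
      ∑ i, a i * (if χ i = 1 then 1 else 0) := by
    rw [div_eq_iff hq, Finset.sum_mul]
    simp only [hf]
    rw [Finset.sum_comm]
    refine Finset.sum_congr rfl fun i _ => ?_
    rw [← Finset.mul_sum, mul_assoc]
    congr 1
    split_ifs with h1
    · rw [h1, MulChar.sum_one_eq_card_units, Fintype.card_units,
        Nat.cast_sub Fintype.card_pos]
      simp
    · rw [MulChar.sum_eq_zero_of_ne_one h1, zero_mul]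
  have hcorr : ∑ x, f x * f (x + h) =
      ∑ i, ∑ j, a i * a j * ∑ x, χ i x * χ j (x + h) := by
    simp only [hf, Finset.sum_mul_sum]
    simp only [Finset.mul_sum]
    rw [Finset.sum_comm]
    refine Finset.sum_congr rfl fun i _ => ?_
    rw [Finset.sum_comm]
    exact Finset.sum_congr rfl fun j _ => Finset.sum_congr rfl fun x _ => by ring
  rw [hmean, hcorr, sq, Finset.sum_mul_sum, Finset.sum_mul, ← Finset.sum_sub_distrib]
  simp only [Finset.sum_mul]
  calc _ = ‖∑ i, ∑ j, a i * a j * (∑ x, χ i x * χ j (x + h) - (if χ i = 1 then 1 else 0) *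
          (if χ j = 1 then 1 else 0) * ((Fintype.card F : ℂ) - 2))‖ := by
        congr 1
        refine Finset.sum_congr rfl fun i _ => ?_
        rw [← Finset.sum_sub_distrib]
        exact Finset.sum_congr rfl fun j _ => by ring
    _ ≤ ∑ i, ∑ j, ‖a i‖ * ‖a j‖ * √(Fintype.card F) := by
        refine norm_sum_le_of_le _ fun i _ => norm_sum_le_of_le _ fun j _ => ?_
        rw [norm_mul, norm_mul]
        exact mul_le_mul_of_nonneg_left (norm_sum_mulChar_mul_shift_sub_le _ _ hh) (by positivity)
    _ = (∑ i, ‖a i‖) ^ 2 * √(Fintype.card F) := by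
        rw [sq, Finset.sum_mul_sum, Finset.sum_mul]
        simp only [Finset.sum_mul]
    _ ≤ M ^ 2 * √(Fintype.card F) := by gcongr

end Correlation

section Windows

/-- If all nontrivial autocorrelations of `f` are within `E` of `κ`, then the alternating sums of
`f` over windows of even length `L` have large mean square. -/
lemma le_sum_sq_alternating_window {p : ℕ} [NeZero p] (f : ZMod p → ℝ) {κ E : ℝ}
    (hE : 0 ≤ E) (hf : ∀ h : ZMod p, h ≠ 0 → |∑ x, f x * f (x + h) - κ| ≤ E)
    {L : ℕ} (hL : Even L) (hLp : L ≤ p) :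
    L * (∑ x, f x ^ 2 - κ) - L ^ 2 * E ≤
      ∑ x, (∑ i ∈ Finset.range L, (-1) ^ i * f (x + i)) ^ 2 := by
  set N := ∑ x, f x ^ 2
  have hcorr : ∀ i j : ℕ, ∑ x, f (x + i) * f (x + j) = ∑ x, f x * f (x + ((j : ZMod p) - i)) := by
    intro i j
    rw [← Equiv.sum_comp (Equiv.subRight (i : ZMod p))]
    refine Finset.sum_congr rfl fun x _ => ?_
    simp only [Equiv.subRight_apply, sub_add_cancel]
    congr 2
    ring
  have hterm : ∀ i ∈ Finset.range L, ∀ j ∈ Finset.range L,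
      -E ≤ (-1) ^ i * (-1) ^ j * (∑ x, f (x + i) * f (x + j) - κ - if i = j then N - κ else 0) := by
    intro i hi j hj
    rw [hcorr]
    have habs : |((-1 : ℝ)) ^ i * (-1) ^ j| = 1 := by simp
    refine (abs_le.1 ?_).1
    rw [abs_mul, habs, one_mul]
    split_ifs with hij
    · simpa [hij, N, sq] using hE
    · rw [sub_zero]
      refine hf _ fun h0 => hij ?_
      rw [sub_eq_zero, ZMod.natCast_eq_natCast_iff', Nat.mod_eq_of_lt, Nat.mod_eq_of_lt] at h0
      · exact h0.symm
      · exact (Finset.mem_range.1 hi).trans_le hLp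
      · exact (Finset.mem_range.1 hj).trans_le hLp
  have hsign : ∑ i ∈ Finset.range L, (-1 : ℝ) ^ i = 0 := by
    rw [neg_one_geom_sum, if_pos hL]
  have hexpand : ∑ x, (∑ i ∈ Finset.range L, (-1) ^ i * f (x + i)) ^ 2 =
      ∑ i ∈ Finset.range L, ∑ j ∈ Finset.range L,
        (-1) ^ i * (-1) ^ j * ∑ x, f (x + i) * f (x + j) := by
    simp only [sq, Finset.sum_mul_sum]
    simp only [Finset.mul_sum]
    rw [Finset.sum_comm]
    refine Finset.sum_congr rfl fun i _ => ?_
    rw [Finset.sum_comm]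
    exact Finset.sum_congr rfl fun j _ => Finset.sum_congr rfl fun x _ => by ring
  have hmain : ∑ i ∈ Finset.range L, ∑ j ∈ Finset.range L, (-1 : ℝ) ^ i * (-1) ^ j * κ = 0 := by
    simp only [← Finset.sum_mul, ← Finset.mul_sum, hsign, mul_zero, zero_mul, Finset.sum_const_zero]
  have hdiag : ∑ i ∈ Finset.range L, ∑ j ∈ Finset.range L,
      (-1 : ℝ) ^ i * (-1) ^ j * (if i = j then N - κ else 0) = L * (N - κ) := by
    have : ∀ i ∈ Finset.range L, ∑ j ∈ Finset.range L,
        (-1 : ℝ) ^ i * (-1) ^ j * (if i = j then N - κ else 0) = N - κ := by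
      intro i hi
      simp only [mul_ite, mul_zero, Finset.sum_ite_eq, hi, if_true, ← mul_pow]
      simp
    rw [Finset.sum_congr rfl this, Finset.sum_const, Finset.card_range, nsmul_eq_mul]
  have hlow : ∑ i ∈ Finset.range L, ∑ j ∈ Finset.range L, -E ≤
      ∑ i ∈ Finset.range L, ∑ j ∈ Finset.range L, (-1) ^ i * (-1) ^ j *
        (∑ x, f (x + i) * f (x + j) - κ - if i = j then N - κ else 0) :=
    Finset.sum_le_sum fun i hi => Finset.sum_le_sum fun j hj => hterm i hi j hj
  simp only [mul_sub, Finset.sum_sub_distrib] at hlow hmain hdiag ⊢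
  rw [← hexpand, hmain, hdiag] at hlow
  simp only [Finset.sum_const, Finset.card_range, nsmul_eq_mul] at hlow
  nlinarith

/-- The partial alternating sums over a strictly increasing list of alternating parities take
at most two values. -/
lemma alternating_sum_range_of_isChain (a : ℕ) (l : List ℕ) (hs : (a :: l).Pairwise (· < ·))
    (hc : (a :: l).IsChain fun x y => Odd (x + y)) (y : ℕ) :
    ∑ g ∈ Finset.range y, (if g ∈ a :: l then (-1 : ℝ) ^ g else 0) = 0 ∨
      ∑ g ∈ Finset.range y, (if g ∈ a :: l then (-1 : ℝ) ^ g else 0) = (-1) ^ a := by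
  rcases le_or_gt y a with hya | hya
  · left
    refine Finset.sum_eq_zero fun g hg => if_neg fun hmem => ?_
    have hg := Finset.mem_range.1 hg
    rcases List.mem_cons.1 hmem with rfl | h
    · omega
    · have := (List.pairwise_cons.1 hs).1 g h
      omega
  have hsplit : ∑ g ∈ Finset.range y, (if g ∈ a :: l then (-1 : ℝ) ^ g else 0) =
      (-1) ^ a + ∑ g ∈ Finset.range y, (if g ∈ l then (-1 : ℝ) ^ g else 0) := by
    have : ∀ g, (if g ∈ a :: l then (-1 : ℝ) ^ g else 0) =
        (if a = g then (-1) ^ g else 0) + (if g ∈ l then (-1 : ℝ) ^ g else 0) := by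
      intro g
      by_cases hg : a = g
      · subst hg
        have : a ∉ l := fun h => lt_irrefl _ ((List.pairwise_cons.1 hs).1 a h)
        simp [this]
      · simp [hg, Ne.symm hg]
    simp only [this, Finset.sum_add_distrib, Finset.sum_ite_eq, Finset.mem_range, hya, if_true]
  rw [hsplit]
  match l, hs, hc with
  | [], _, _ => simp
  | b :: l, hs, hc =>
    rw [List.isChain_cons_cons] at hc
    have hab : (-1 : ℝ) ^ a + (-1) ^ b = 0 := by
      have : (-1 : ℝ) ^ a * (-1) ^ b = -1 := by rw [← pow_add, hc.1.neg_one_pow]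
      rcases neg_one_pow_eq_or ℝ a with h | h <;> rw [h] at this ⊢ <;> linarith
    rcases alternating_sum_range_of_isChain b l (List.pairwise_cons.1 hs).2 hc.2 y with h | h
    · right; rw [h, add_zero]
    · left; rw [h, hab]

/-- The alternating window sums of the indicator of a strictly increasing list of residues of
alternating parities have small mean square. -/
lemma sum_sq_alternating_window_le {p : ℕ} [NeZero p] {l : List ℕ} (hs : l.Pairwise (· < ·))
    (hc : l.IsChain fun x y => Odd (x + y)) (f : ZMod p → ℝ)
    (hf : ∀ g < p, f (g : ZMod p) = if g ∈ l then 1 else 0) (L : ℕ) :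
    ∑ x, (∑ i ∈ Finset.range L, (-1) ^ i * f (x + i)) ^ 2 ≤ p + (L : ℝ) ^ 3 := by
  have hA : ∃ ε : ℝ, |ε| ≤ 1 ∧ ∀ y,
      ∑ g ∈ Finset.range y, (if g ∈ l then (-1 : ℝ) ^ g else 0) = 0 ∨
      ∑ g ∈ Finset.range y, (if g ∈ l then (-1 : ℝ) ^ g else 0) = ε := by
    match l, hs, hc with
    | [], _, _ => exact ⟨0, by simp, by simp⟩
    | a :: l, hs, hc =>
      exact ⟨(-1) ^ a, by simp, alternating_sum_range_of_isChain a l hs hc⟩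
  obtain ⟨ε, hε, hA⟩ := hA
  have hfle : ∀ x, |f x| ≤ 1 := by
    intro x
    rw [← ZMod.natCast_zmod_val x, hf _ (ZMod.val_lt x)]
    split_ifs <;> simp
  have hinner : ∀ x : ZMod p, x.val + L ≤ p →
      (∑ i ∈ Finset.range L, (-1) ^ i * f (x + i)) ^ 2 ≤ 1 := by
    intro x hx
    have hshift : (-1) ^ x.val * ∑ i ∈ Finset.range L, (-1) ^ i * f (x + i) =
        ∑ g ∈ Finset.range (x.val + L), (if g ∈ l then (-1 : ℝ) ^ g else 0) -
          ∑ g ∈ Finset.range x.val, (if g ∈ l then (-1 : ℝ) ^ g else 0) := by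
      rw [Finset.sum_range_add, add_sub_cancel_left, Finset.mul_sum]
      refine Finset.sum_congr rfl fun i hi => ?_
      have hi := Finset.mem_range.1 hi
      have : x + (i : ZMod p) = ((x.val + i : ℕ) : ZMod p) := by
        rw [Nat.cast_add, ZMod.natCast_zmod_val]
      rw [this, hf _ (by omega)]
      split_ifs
      · rw [pow_add, mul_one]
      · simp
    have hsq : (∑ i ∈ Finset.range L, (-1) ^ i * f (x + i)) ^ 2 =
        ((-1) ^ x.val * ∑ i ∈ Finset.range L, (-1) ^ i * f (x + i)) ^ 2 := by
      rw [mul_pow, ← pow_mul, mul_comm x.val, pow_mul]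
      simp
    rw [hsq, hshift, sq_le_one_iff_abs_le_one]
    rcases hA (x.val + L) with h1 | h1 <;> rcases hA x.val with h2 | h2 <;> rw [h1, h2] <;>
      simp [hε]
  have houter : ∀ x : ZMod p, (∑ i ∈ Finset.range L, (-1) ^ i * f (x + i)) ^ 2 ≤ (L : ℝ) ^ 2 := by
    intro x
    refine sq_le_sq.2 ?_
    rw [Nat.abs_cast]
    calc _ ≤ ∑ i ∈ Finset.range L, |(-1) ^ i * f (x + i)| := Finset.abs_sum_le_sum_abs _ _
      _ ≤ ∑ i ∈ Finset.range L, (1 : ℝ) :=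
        Finset.sum_le_sum fun i _ => by simpa [abs_mul] using hfle (x + i)
      _ = L := by simp
  have hcard : (Finset.univ.filter fun x : ZMod p => ¬x.val + L ≤ p).card ≤ L := by
    calc _ ≤ (Finset.Ico (p - L) p).card := by
          refine Finset.card_le_card_of_injOn ZMod.val (fun x hx => ?_)
            ((ZMod.val_injective p).injOn)
          have h1 := ZMod.val_lt x
          simp only [Finset.coe_filter, Finset.mem_univ, true_and, Set.mem_ofPred_eq] at hx
          simp only [Finset.coe_Ico, Set.mem_Ico]
          omega
      _ ≤ L := by rw [Nat.card_Ico]; omega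
  rw [← Finset.sum_filter_add_sum_filter_not _ (fun x : ZMod p => x.val + L ≤ p)]
  refine add_le_add ?_ ?_
  · refine (Finset.sum_le_card_nsmul _ _ 1 fun x hx =>
      hinner x (Finset.mem_filter.1 hx).2).trans ?_
    rw [nsmul_eq_mul, mul_one, Nat.cast_le]
    exact (Finset.card_le_univ _).trans_eq (ZMod.card p)
  · refine (Finset.sum_le_card_nsmul _ _ _ fun x _ => houter x).trans ?_
    rw [nsmul_eq_mul, pow_succ' (L : ℝ) 2]
    exact mul_le_mul_of_nonneg_right (by exact_mod_cast hcard) (by positivity)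

end Windows

section Arithmetic

lemma pow_card_primeFactors_le (K : ℕ) {n : ℕ} (hn : n ≠ 0) :
    K ^ n.primeFactors.card ≤ (K + 1) ^ (K + 1) * n := by
  have hterm : ∀ l ∈ n.primeFactors, K ≤ (if l < K + 1 then K + 1 else 1) * l := by
    intro l hl
    have := (Nat.prime_of_mem_primeFactors hl).pos
    split_ifs with h
    · nlinarith
    · omega
  calc K ^ n.primeFactors.card
      = ∏ l ∈ n.primeFactors, K := by rw [Finset.prod_const]
    _ ≤ ∏ l ∈ n.primeFactors, (if l < K + 1 then K + 1 else 1) * l :=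
        Finset.prod_le_prod' hterm
    _ = (K + 1) ^ (n.primeFactors.filter (· < K + 1)).card * ∏ l ∈ n.primeFactors, l := by
        rw [Finset.prod_mul_distrib, Finset.prod_ite, Finset.prod_const, Finset.prod_const_one,
          mul_one]
    _ ≤ (K + 1) ^ (K + 1) * n := by
        refine Nat.mul_le_mul (Nat.pow_le_pow_right (by omega) ?_)
          (Nat.le_of_dvd (Nat.pos_of_ne_zero hn) (Nat.prod_primeFactors_dvd n))
        calc _ ≤ (Finset.range (K + 1)).card :=
              Finset.card_le_card fun l hl => Finset.mem_range.2 (Finset.mem_filter.1 hl).2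
          _ = K + 1 := Finset.card_range _

lemma le_totient_mul_two_pow_card_primeFactors (n : ℕ) :
    n ≤ n.totient * 2 ^ n.primeFactors.card := by
  have hle : ∏ l ∈ n.primeFactors, l ≤
      2 ^ n.primeFactors.card * ∏ l ∈ n.primeFactors, (l - 1) := by
    rw [← Finset.prod_const, ← Finset.prod_mul_distrib]
    refine Finset.prod_le_prod' fun l hl => ?_
    have := (Nat.prime_of_mem_primeFactors hl).two_le
    omega
  have hpos : 0 < ∏ l ∈ n.primeFactors, (l - 1) := Finset.prod_pos fun l hl => by
    have := (Nat.prime_of_mem_primeFactors hl).two_le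
    omega
  refine Nat.le_of_mul_le_mul_right ?_ hpos
  rw [← Nat.totient_mul_prod_primeFactors, mul_assoc]
  exact Nat.mul_le_mul_left _ hle

lemma two_mul_totient_le {n : ℕ} (hn : Even n) : 2 * n.totient ≤ n := by
  rcases Nat.eq_zero_or_pos n with rfl | hpos
  · simp
  have hmem : 2 ∈ n.primeFactors := Nat.mem_primeFactors.2 ⟨Nat.prime_two, hn.two_dvd, hpos.ne'⟩
  have h := Nat.totient_mul_prod_primeFactors n
  rw [← Finset.mul_prod_erase _ _ hmem, ← Finset.mul_prod_erase _ (fun l => l - 1) hmem] at h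
  have hle : ∏ l ∈ n.primeFactors.erase 2, (l - 1) ≤ ∏ l ∈ n.primeFactors.erase 2, l :=
    Finset.prod_le_prod' fun l _ => Nat.sub_le _ _
  have hpos' : 0 < ∏ l ∈ n.primeFactors.erase 2, l := Finset.prod_pos fun l hl =>
    (Nat.prime_of_mem_primeFactors (Finset.mem_of_mem_erase hl)).pos
  refine Nat.le_of_mul_le_mul_right ?_ hpos'
  calc 2 * n.totient * ∏ l ∈ n.primeFactors.erase 2, l
      = n * ((2 - 1) * ∏ l ∈ n.primeFactors.erase 2, (l - 1)) := by rw [← h]; ring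
    _ ≤ n * ∏ l ∈ n.primeFactors.erase 2, l := by
        rw [Nat.add_one_sub_one, one_mul]; exact Nat.mul_le_mul_left _ hle

end Arithmetic

section PrimitiveRoots

variable {p : ℕ}

lemma card_orderOf_eq_totient_zmod [Fact p.Prime] :
    (Finset.univ.filter fun x : ZMod p => orderOf x = p - 1).card = (p - 1).totient := by
  classical
  have hcard : Fintype.card (ZMod p)ˣ = p - 1 := ZMod.card_units p
  rw [← IsCyclic.card_orderOf_eq_totient (α := (ZMod p)ˣ) (d := p - 1)
    hcard.symm.dvd]
  symm
  refine Finset.card_bij (fun u _ => (u : ZMod p)) (fun u hu => ?_)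
    (fun u _ v _ h => Units.ext h) fun x hx => ?_
  · simpa [orderOf_units] using hu
  · have hx := (Finset.mem_filter.1 hx).2
    have h0 : x ≠ 0 := by
      rintro rfl
      have := (Fact.out : p.Prime).two_le
      rw [orderOf_zero] at hx
      omega
    exact ⟨Units.mk0 x h0, by simp [← orderOf_units, hx], rfl⟩

lemma mem_primRootsList {g : ℕ} :
    g ∈ primRootsList p ↔ (1 ≤ g ∧ g < p) ∧ orderOf (g : ZMod p) = p - 1 := by
  simp [primRootsList]

lemma pairwise_primRootsList : (primRootsList p).Pairwise (· < ·) :=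
  Finset.sortedLT_sort _ |>.pairwise

lemma mem_primRootsList_of_lt [Fact p.Prime] {g : ℕ} (hg : g < p) :
    g ∈ primRootsList p ↔ orderOf (g : ZMod p) = p - 1 := by
  rw [mem_primRootsList]
  refine ⟨fun h => h.2, fun h => ⟨⟨Nat.pos_of_ne_zero ?_, hg⟩, h⟩⟩
  rintro rfl
  have := (Fact.out : p.Prime).two_le
  rw [Nat.cast_zero, orderOf_zero] at h
  omega

lemma length_primRootsList [Fact p.Prime] : (primRootsList p).length = (p - 1).totient := by
  rw [primRootsList, Finset.length_sort, ← card_orderOf_eq_totient_zmod (p := p)]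
  refine Finset.card_bij (fun g _ => (g : ZMod p)) (fun g hg => ?_) (fun a ha b hb h => ?_)
    fun x hx => ⟨x.val, ?_, ZMod.natCast_zmod_val x⟩
  · simpa using (Finset.mem_filter.1 hg).2
  · simp only [Finset.mem_filter, Finset.mem_Ico] at ha hb
    rwa [ZMod.natCast_eq_natCast_iff', Nat.mod_eq_of_lt ha.1.2, Nat.mod_eq_of_lt hb.1.2] at h
  · have := (mem_primRootsList_of_lt (ZMod.val_lt x)).2
      (by rw [ZMod.natCast_zmod_val]; exact (Finset.mem_filter.1 hx).2)
    simpa [primRootsList] using this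

/-- Pair correlations of the primitive roots modulo `p`. -/
lemma abs_primitiveRoot_correlation_sub_le [Fact p.Prime] {h : ZMod p} (hh : h ≠ 0) :
    |∑ x : ZMod p, (if orderOf x = p - 1 then 1 else 0) *
        (if orderOf (x + h) = p - 1 then 1 else 0) -
      ((p - 1).totient / ((p : ℝ) - 1)) ^ 2 * ((p : ℝ) - 2)| ≤
      (2 ^ (p - 1).primeFactors.card) ^ 2 * √p := by
  have hexp := hasCharExpansion_orderOf (F := ZMod p)
  have hc := hexp.norm_correlation_sub_le hh
  rw [ZMod.card] at hc
  have hsum : ∑ x : ZMod p, (if orderOf x = p - 1 then (1 : ℂ) else 0) = (p - 1).totient := by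
    rw [Finset.sum_boole, card_orderOf_eq_totient_zmod]
  rw [hsum] at hc
  refine le_trans (le_of_eq ?_) hc
  rw [← Real.norm_eq_abs, ← Complex.norm_real]
  push_cast
  simp only [apply_ite Complex.ofReal, Complex.ofReal_one, Complex.ofReal_zero]

lemma exists_two_pow_card_primeFactors_bound :
    ∃ P : ℕ, ∀ p : ℕ, 1 < p → P ≤ p →
      82 * (2 ^ (p - 1).primeFactors.card : ℝ) ^ 4 < √p := by
  obtain ⟨C, hC⟩ : ∃ C : ℕ, ∀ n ≠ 0, (2 ^ 16) ^ n.primeFactors.card ≤ C * n :=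
    ⟨_, fun n hn => pow_card_primeFactors_le _ hn⟩
  refine ⟨82 ^ 4 * C, fun p hp hP => lt_of_pow_lt_pow_left₀ 4 (Real.sqrt_nonneg _) ?_⟩
  have hsqrt : √(p : ℝ) ^ 4 = p * p := by
    rw [show 4 = 2 * 2 from rfl, pow_mul, Real.sq_sqrt (Nat.cast_nonneg _), sq]
  have hM : ((2 : ℝ) ^ (p - 1).primeFactors.card) ^ 16 =
      (((2 ^ 16) ^ (p - 1).primeFactors.card : ℕ) : ℝ) := by
    rw [Nat.cast_pow, Nat.cast_pow, Nat.cast_ofNat, ← pow_mul, ← pow_mul, mul_comm]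
  have hnat : 82 ^ 4 * (2 ^ 16) ^ (p - 1).primeFactors.card < p * p := by
    calc 82 ^ 4 * (2 ^ 16) ^ (p - 1).primeFactors.card
        ≤ 82 ^ 4 * (C * (p - 1)) := Nat.mul_le_mul_left _ (hC _ (by omega))
      _ = 82 ^ 4 * C * (p - 1) := by ring
      _ ≤ p * (p - 1) := Nat.mul_le_mul_right _ hP
      _ < p * p := Nat.mul_lt_mul_of_pos_left (by omega) (by omega)
  rw [hsqrt, mul_pow, ← pow_mul, hM]
  exact_mod_cast hnat

/-- The primitive roots in increasing order do not all have the same parity. -/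
lemma not_isChain_even_primRootsList [Fact p.Prime]
    (hp : 82 * (2 ^ (p - 1).primeFactors.card : ℝ) ^ 4 < √p) :
    ¬(primRootsList p).IsChain fun x y => Even (x + y) := by
  intro hc
  set M : ℝ := 2 ^ (p - 1).primeFactors.card with hMdef
  have hM1 : 1 ≤ M := one_le_pow₀ one_le_two
  have hM4 : 1 ≤ M ^ 4 := one_le_pow₀ hM1
  have hsq : √(p : ℝ) ^ 2 = p := Real.sq_sqrt (Nat.cast_nonneg _)
  have hp2 : (4 : ℝ) ≤ p := by nlinarith
  have htot : (p : ℝ) - 1 ≤ (p - 1).totient * M := by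
    have := le_totient_mul_two_pow_card_primeFactors (p - 1)
    have h : ((p - 1 : ℕ) : ℝ) ≤ ((p - 1).totient * 2 ^ (p - 1).primeFactors.card : ℕ) := by
      exact_mod_cast this
    push_cast [Nat.cast_sub (Fact.out : p.Prime).one_le] at h
    exact h
  have hpar : ∀ i (hi : i < (primRootsList p).length),
      Even ((primRootsList p)[i] + (primRootsList p)[0]) := by
    intro i
    induction i with
    | zero => exact fun hi => ⟨_, rfl⟩
    | succ i ih =>
      intro hi
      have h1 := ih (by omega)
      have h2 := List.isChain_iff_getElem.1 hc i hi
      rw [Nat.even_add] at h1 h2 ⊢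
      tauto
  have hsame : ∀ a ∈ primRootsList p, ∀ b ∈ primRootsList p, Even (a + b) := by
    intro a ha b hb
    obtain ⟨i, hi, rfl⟩ := List.getElem_of_mem ha
    obtain ⟨j, hj, rfl⟩ := List.getElem_of_mem hb
    have h1 := hpar i hi
    have h2 := hpar j hj
    rw [Nat.even_add] at h1 h2 ⊢
    tauto
  have hcorr := (abs_le.1 (abs_primitiveRoot_correlation_sub_le (p := p) one_ne_zero)).1
  rw [← hMdef] at hcorr
  have hzero : ∑ x : ZMod p, (if orderOf x = p - 1 then (1 : ℝ) else 0) *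
      (if orderOf (x + 1) = p - 1 then 1 else 0) = 0 := by
    refine Finset.sum_eq_zero fun x _ => ?_
    by_contra hne
    have hx : orderOf x = p - 1 := by
      by_contra h; simp [h] at hne
    have hx1 : orderOf (x + 1) = p - 1 := by
      by_contra h; simp [h] at hne
    have hmem : x.val ∈ primRootsList p := by
      rw [mem_primRootsList_of_lt (ZMod.val_lt x), ZMod.natCast_zmod_val, hx]
    have hlt : x.val + 1 < p := by
      refine lt_of_le_of_ne (ZMod.val_lt x) fun h => ?_
      have h0 : x + 1 = 0 := by
        rw [← ZMod.natCast_zmod_val x, ← Nat.cast_one, ← Nat.cast_add, h, ZMod.natCast_self]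
      have := (Fact.out : p.Prime).two_le
      rw [h0, orderOf_zero] at hx1
      omega
    have hmem1 : x.val + 1 ∈ primRootsList p := by
      rw [mem_primRootsList_of_lt hlt, Nat.cast_add, ZMod.natCast_zmod_val, Nat.cast_one, hx1]
    have := hsame _ hmem _ hmem1
    rw [← add_assoc, ← two_mul] at this
    exact Nat.not_even_iff_odd.2 ⟨_, rfl⟩ this
  rw [hzero] at hcorr
  have hθ : 1 ≤ (p - 1).totient / ((p : ℝ) - 1) * M := by
    rw [div_mul_eq_mul_div, one_le_div (by linarith)]
    exact htot
  set θ : ℝ := (p - 1).totient / ((p : ℝ) - 1)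
  have h1 : 1 ≤ (θ * M) ^ 2 := one_le_pow₀ hθ
  have h2 : (p : ℝ) - 2 ≤ M ^ 4 * √p := by
    calc (p : ℝ) - 2 ≤ (θ * M) ^ 2 * (p - 2) := by nlinarith
      _ = M ^ 2 * (θ ^ 2 * (p - 2)) := by ring
      _ ≤ M ^ 2 * (M ^ 2 * √p) := mul_le_mul_of_nonneg_left (by linarith) (by positivity)
      _ = M ^ 4 * √p := by ring
  nlinarith

/-- The primitive roots in increasing order do not alternate in parity. -/
lemma not_isChain_odd_primRootsList [Fact p.Prime]
    (hp : 82 * (2 ^ (p - 1).primeFactors.card : ℝ) ^ 4 < √p) :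
    ¬(primRootsList p).IsChain fun x y => Odd (x + y) := by
  intro hc
  set m : ℕ := 2 ^ (p - 1).primeFactors.card with hm
  have hcast : (2 : ℝ) ^ (p - 1).primeFactors.card = m := by simp [hm]
  rw [hcast] at hp
  have hM1 : (1 : ℝ) ≤ m := by exact_mod_cast Nat.one_le_two_pow
  have hM4 : (1 : ℝ) ≤ (m : ℝ) ^ 4 := one_le_pow₀ hM1
  have hM14 : (m : ℝ) ≤ (m : ℝ) ^ 4 := le_self_pow₀ hM1 (by norm_num)
  have hM34 : (m : ℝ) ^ 3 ≤ (m : ℝ) ^ 4 := pow_le_pow_right₀ hM1 (by norm_num)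
  have hsq : √(p : ℝ) ^ 2 = p := Real.sq_sqrt (Nat.cast_nonneg _)
  have hs1 : 82 ≤ √(p : ℝ) := by linarith
  have hp2 : 82 * √(p : ℝ) ≤ p := by nlinarith
  have hLp : 4 * m ≤ p := by
    have : (4 : ℝ) * m ≤ p := by nlinarith
    exact_mod_cast this
  have hone := (Fact.out : p.Prime).one_le
  have htot : (p : ℝ) - 1 ≤ (p - 1).totient * m := by
    have h : ((p - 1 : ℕ) : ℝ) ≤ ((p - 1).totient * m : ℕ) := by
      exact_mod_cast le_totient_mul_two_pow_card_primeFactors (p - 1)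
    push_cast [Nat.cast_sub hone] at h
    exact h
  have heven : Even (p - 1) := by
    refine (Fact.out : p.Prime).even_sub_one fun h => ?_
    have hlt : (2 : ℝ) < p := by linarith
    rw [h] at hlt
    exact lt_irrefl _ hlt
  have hhalf : 2 * ((p - 1).totient : ℝ) ≤ (p : ℝ) - 1 := by
    have h : ((2 * (p - 1).totient : ℕ) : ℝ) ≤ (p - 1 : ℕ) := by
      exact_mod_cast two_mul_totient_le heven
    push_cast [Nat.cast_sub hone] at h
    exact h
  set t : ℝ := ((p - 1).totient : ℝ)
  have ht0 : 0 ≤ t := Nat.cast_nonneg _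
  have hκ : (t / ((p : ℝ) - 1)) ^ 2 * ((p : ℝ) - 2) ≤ t / 2 := by
    have hpos : (0 : ℝ) < (p : ℝ) - 1 := by linarith
    have hle : t / ((p : ℝ) - 1) ≤ 1 / 2 := by
      rw [div_le_iff₀ hpos]; linarith
    have hge : 0 ≤ t / ((p : ℝ) - 1) := by positivity
    calc (t / ((p : ℝ) - 1)) ^ 2 * ((p : ℝ) - 2)
        ≤ (t / ((p : ℝ) - 1)) ^ 2 * ((p : ℝ) - 1) :=
          mul_le_mul_of_nonneg_left (by linarith) (by positivity)
      _ = t / ((p : ℝ) - 1) * t := by field_simp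
      _ ≤ 1 / 2 * t := mul_le_mul_of_nonneg_right hle ht0
      _ = t / 2 := by ring
  have hlow := le_sum_sq_alternating_window (p := p)
    (fun x => if orderOf x = p - 1 then (1 : ℝ) else 0)
    (κ := (t / ((p : ℝ) - 1)) ^ 2 * ((p : ℝ) - 2)) (E := (m : ℝ) ^ 2 * √p) (by positivity)
    (fun h hh => hcast ▸ abs_primitiveRoot_correlation_sub_le hh)
    (L := 4 * m) ⟨2 * m, by ring⟩ hLp
  have hupp := sum_sq_alternating_window_le (p := p) pairwise_primRootsList hc
    (fun x => if orderOf x = p - 1 then (1 : ℝ) else 0)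
    (fun g hg => by simp only [mem_primRootsList_of_lt hg]) (4 * m)
  have hN : ∑ x : ZMod p, (if orderOf x = p - 1 then (1 : ℝ) else 0) ^ 2 = t := by
    simp only [ite_pow, one_pow, zero_pow two_ne_zero]
    rw [Finset.sum_boole, card_orderOf_eq_totient_zmod]
  rw [hN] at hlow
  have hmain := hlow.trans hupp
  push_cast at hmain
  have h1 : 2 * ((p : ℝ) - 1) ≤
      4 * m * (t - (t / ((p : ℝ) - 1)) ^ 2 * ((p : ℝ) - 2)) := by
    calc 2 * ((p : ℝ) - 1) ≤ 4 * m * (t / 2) := by linarith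
      _ ≤ _ := mul_le_mul_of_nonneg_left (by linarith) (by positivity)
  have h2 : (p : ℝ) ≤ 2 + 64 * (m : ℝ) ^ 3 + 16 * ((m : ℝ) ^ 4 * √p) := by
    have e1 : (4 * (m : ℝ)) ^ 3 = 64 * (m : ℝ) ^ 3 := by ring
    have e2 : (4 * (m : ℝ)) ^ 2 * ((m : ℝ) ^ 2 * √p) = 16 * ((m : ℝ) ^ 4 * √p) := by ring
    rw [e1, e2] at hmain
    linarith
  have h3 : (m : ℝ) ^ 4 ≤ (m : ℝ) ^ 4 * √p := le_mul_of_one_le_right (by positivity) (by linarith)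
  have h4 : 82 * (m : ℝ) ^ 4 * √p < √p * √p :=
    mul_lt_mul_of_pos_right hp (by linarith)
  nlinarith

end PrimitiveRoots

section TwoAdic

variable {p : ℕ}

lemma seqS_of_lt [Fact p.Prime] {n : ℕ} (hn : n < (p - 1).totient - 1)
    (hn' : n + 1 < (primRootsList p).length) :
    seqS p n = ((primRootsList p)[n] + (primRootsList p)[n + 1]) % 2 := by
  rw [seqS, Nat.mod_eq_of_lt hn, List.getD_eq_getElem _ _ (by omega), List.getD_eq_getElem _ _ hn']

/-- If the sequence is not constant, then `2 ^ T - 1` does not divide `S(2)`. -/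
lemma not_dvd_Stwo [Fact p.Prime]
    (h0 : ¬(primRootsList p).IsChain fun x y => Even (x + y))
    (h1 : ¬(primRootsList p).IsChain fun x y => Odd (x + y)) :
    ¬2 ^ ((p - 1).totient - 1) - 1 ∣ Stwo p := by
  have hlen := length_primRootsList (p := p)
  have hgeom : ∑ n ∈ Finset.range ((p - 1).totient - 1), 2 ^ n =
      2 ^ ((p - 1).totient - 1) - 1 := by
    rw [Nat.geomSum_eq le_rfl, Nat.add_one_sub_one, Nat.div_one]
  have hle : ∀ n ∈ Finset.range ((p - 1).totient - 1), seqS p n * 2 ^ n ≤ 2 ^ n := by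
    intro n _
    have : seqS p n ≤ 1 := Nat.le_of_lt_succ (Nat.mod_lt _ two_pos)
    exact mul_le_of_le_one_left (Nat.zero_le _) this
  intro hdvd
  rcases Nat.eq_zero_or_pos (Stwo p) with hS | hS
  · refine h0 (List.isChain_iff_getElem.2 fun n hn => ?_)
    have hn' : n < (p - 1).totient - 1 := by omega
    have := (Finset.sum_eq_zero_iff.1 hS) n (Finset.mem_range.2 hn')
    rw [seqS_of_lt hn' hn] at this
    exact Nat.even_iff.2 ((mul_eq_zero.1 this).resolve_right (by positivity))
  · have hS' : Stwo p = ∑ n ∈ Finset.range ((p - 1).totient - 1), 2 ^ n :=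
      le_antisymm (Finset.sum_le_sum hle) (hgeom ▸ Nat.le_of_dvd hS hdvd)
    refine h1 (List.isChain_iff_getElem.2 fun n hn => ?_)
    have hn' : n < (p - 1).totient - 1 := by omega
    have := (Finset.sum_eq_sum_iff_of_le hle).1 hS' n (Finset.mem_range.2 hn')
    rw [seqS_of_lt hn' hn] at this
    exact Nat.odd_iff.2 (Nat.eq_of_mul_eq_mul_right (by positivity) (this.trans (one_mul _).symm))

lemma minFac_le_div_gcd {N S : ℕ} (hN : N ≠ 0) (h : ¬N ∣ S) :
    N.minFac ≤ N / N.gcd S := by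
  have hg := Nat.gcd_dvd_left N S
  refine Nat.minFac_le_of_dvd ?_ (Nat.div_dvd_of_dvd hg)
  have hpos : 0 < N / N.gcd S := Nat.div_pos (Nat.le_of_dvd (Nat.pos_of_ne_zero hN) hg)
    (Nat.gcd_pos_of_pos_left _ (Nat.pos_of_ne_zero hN))
  by_contra hlt
  have h1 : N / N.gcd S = 1 := by omega
  have := Nat.div_mul_cancel hg
  rw [h1, one_mul] at this
  exact h (Nat.gcd_eq_left_iff_dvd.1 this)

end TwoAdic

/-- For all sufficiently large primes `p`: if `q` is the smallest prime divisor of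
`2^T - 1`, `T = φ(p-1) - 1`, then `C(s_n) ≥ ⌊log₂ q⌋`. -/
theorem two_adic_complexity_lower_bound :
    ∃ P : ℕ, ∀ p : ℕ, Nat.Prime p → P ≤ p →
      Nat.log 2 (Nat.minFac (2 ^ (Nat.totient (p - 1) - 1) - 1)) ≤ twoAdicComp p := by
  obtain ⟨P, hP⟩ := exists_two_pow_card_primeFactors_bound
  refine ⟨max P 4, fun p hp hPp => ?_⟩
  have : Fact p.Prime := ⟨hp⟩
  have hbound := hP p hp.one_lt (le_of_max_le_left hPp)
  have hT : (p - 1).totient - 1 ≠ 0 := by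
    have hp4 := le_of_max_le_right hPp
    obtain ⟨k, hk⟩ := Nat.totient_even (n := p - 1) (by omega)
    have := Nat.totient_pos.2 (show 0 < p - 1 by omega)
    omega
  have hN : 2 ^ ((p - 1).totient - 1) - 1 ≠ 0 := by
    have := Nat.one_lt_two_pow hT
    omega
  exact Nat.log_mono_right (minFac_le_div_gcd hN (not_dvd_Stwo
    (not_isChain_even_primRootsList hbound) (not_isChain_odd_primRootsList hbound)))
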